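/- Let Ω = (0,1) ⊂ ℝ, with Dirichlet eigenpairs λ_k = k²π² and φ_k(x) = sin(kπx). For u ≡ 1 the coefficients u_k = ∫₀¹ φ_k satisfy u_k = 0 for k even and u_k = 2/(kπ) for k odd, and for every t ≥ 1/2 and every s ∈ (0,1) one has Σ_{k=1}^∞ λ_k^{t−2s} (λ_k^s u_k)² = 4π^{2t−2} Σ_{k=1}^∞ (2k−1)^{2t−2} = +∞; in particular the series defining ‖(−Δ_{D,0})^s 1‖²_{ℍ^{t−2s}(Ω)} diverges for all t ≥ 1/2, so (−Δ_{D,0})^s cannot be applied to the constant function 1 as a map into ℍ^{t−2s}(Ω) with t ≥ 1/2. -/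

import Mathlib

open MeasureTheory Real
open scoped ENNReal

noncomputable section

/-- Fourier coefficient `u_k = ∫_Ω 1 · φ_k` of the constant function `1` on `Ω = (0,1)`,
with `φ_k(x) = sin(kπx)`. -/
def dirCoeffOne (k : ℕ) : ℝ := ∫ x in Set.Ioo (0:ℝ) 1, Real.sin (k * π * x)

/-- The eigenvalue `λ_k = k²π²` of the Dirichlet Laplacian on `(0,1)`. -/
def dirEig (k : ℕ) : ℝ := (k : ℝ) ^ 2 * π ^ 2

theorem dirCoeffOne_eq {k : ℕ} (hk : 1 ≤ k) :
    dirCoeffOne k = (1 - (-1) ^ k) / (k * π) := by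
  have hne : (k : ℝ) * π ≠ 0 := by positivity
  rw [dirCoeffOne, ← integral_Ioc_eq_integral_Ioo, ← intervalIntegral.integral_of_le zero_le_one,
    intervalIntegral.integral_comp_mul_left (fun x => Real.sin x) hne, integral_sin]
  simp [Real.cos_nat_mul_pi]
  field_simp

theorem dirCoeffOne_of_even {k : ℕ} (hk : 1 ≤ k) (h : Even k) : dirCoeffOne k = 0 := by
  simp [dirCoeffOne_eq hk, h.neg_one_pow]

theorem dirCoeffOne_of_odd {k : ℕ} (hk : 1 ≤ k) (h : Odd k) : dirCoeffOne k = 2 / (k * π) := by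
  rw [dirCoeffOne_eq hk, h.neg_one_pow]
  norm_num

theorem dirEig_rpow_mul_sq_of_odd {k : ℕ} (h : Odd k) (t s : ℝ) :
    dirEig k ^ (t - 2 * s) * (dirEig k ^ s * dirCoeffOne k) ^ 2 =
      4 * π ^ (2 * t - 2) * (k : ℝ) ^ (2 * t - 2) := by
  have hk : (0 : ℝ) < k := by exact_mod_cast h.pos
  have hkπ : 0 < (k : ℝ) * π := by positivity
  have hpow (r : ℝ) : dirEig k ^ r = ((k : ℝ) * π) ^ (2 * r) := by
    rw [dirEig, ← mul_pow, ← Real.rpow_natCast_mul hkπ.le]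
    norm_num
  rw [dirCoeffOne_of_odd h.pos h, mul_pow, ← Real.rpow_mul_natCast (by unfold dirEig; positivity),
    hpow, hpow, ← mul_assoc, ← Real.rpow_add hkπ, mul_assoc, mul_comm (π ^ _),
    ← Real.mul_rpow hk.le pi_pos.le, Real.rpow_sub hkπ,
    show 2 * (t - 2 * s) + 2 * (s * (2 : ℕ)) = 2 * t by push_cast; ring, Real.rpow_two]
  ring

theorem not_summable_odd_rpow {r : ℝ} (hr : -1 ≤ r) :
    ¬ Summable (fun k : ℕ => (2 * (k : ℝ) + 1) ^ r) := by
  intro h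
  have hharm : Summable (fun k : ℕ => (2 : ℝ)⁻¹ * (1 / ((k + 1 : ℕ) : ℝ))) := by
    refine h.of_nonneg_of_le (fun k => by positivity) fun k => ?_
    calc (2 : ℝ)⁻¹ * (1 / ((k + 1 : ℕ) : ℝ)) ≤ (2 * (k : ℝ) + 1)⁻¹ := by
          rw [one_div, ← mul_inv]
          gcongr
          push_cast
          linarith
      _ = (2 * (k : ℝ) + 1) ^ (-1 : ℝ) := (Real.rpow_neg_one _).symm
      _ ≤ _ := Real.rpow_le_rpow_of_exponent_le (by linarith [k.cast_nonneg (α := ℝ)]) hr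
  rw [summable_mul_left_iff (by norm_num),
    summable_nat_add_iff 1 (f := fun n : ℕ => 1 / (n : ℝ))] at hharm
  exact Real.not_summable_one_div_natCast hharm

theorem tsum_ofReal_eq_top_of_not_summable {α : Type*} {f : α → ℝ} (hf : ∀ a, 0 ≤ f a)
    (h : ¬ Summable f) : ∑' a, ENNReal.ofReal (f a) = ∞ := by
  by_contra htop
  exact h ((ENNReal.summable_toReal htop).congr fun a => ENNReal.toReal_ofReal (hf a))

/-- On `Ω = (0,1)` with Dirichlet eigenpairs `λ_k = k²π²`,
`φ_k = sin(kπx)`: for `u ≡ 1` the coefficients satisfy `u_k = 0` for `k` even and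
`u_k = 2/(kπ)` for `k` odd, and for every `t ≥ 1/2`, `s ∈ (0,1)` the series
`Σ_k λ_k^{t-2s} (λ_k^s u_k)²` equals `4π^{2t-2} Σ_k (2k-1)^{2t-2}` and diverges; hence
`(−Δ_{D,0})^s 1 ∉ ℍ^{t-2s}(Ω)` for every `t ≥ 1/2`. -/
theorem statement2 :
    (∀ k : ℕ, 1 ≤ k →
      (Even k → dirCoeffOne k = 0) ∧ (Odd k → dirCoeffOne k = 2 / (k * π))) ∧
    (∀ t s : ℝ, 1/2 ≤ t → 0 < s → s < 1 →
      (∑' k : ℕ, ENNReal.ofReal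
          (dirEig (k+1) ^ (t - 2*s) * (dirEig (k+1) ^ s * dirCoeffOne (k+1)) ^ 2)
        = ∑' k : ℕ, ENNReal.ofReal (4 * π ^ (2*t - 2) * (2*(k:ℝ)+1) ^ (2*t - 2))) ∧
      (∑' k : ℕ, ENNReal.ofReal
          (dirEig (k+1) ^ (t - 2*s) * (dirEig (k+1) ^ s * dirCoeffOne (k+1)) ^ 2) = ∞) ∧
      ¬ Summable (fun k : ℕ =>
          dirEig (k+1) ^ (t - 2*s) * (dirEig (k+1) ^ s * dirCoeffOne (k+1)) ^ 2)) := by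
  refine ⟨fun k hk => ⟨dirCoeffOne_of_even hk, dirCoeffOne_of_odd hk⟩, fun t s ht _ _ => ?_⟩
  set f : ℕ → ℝ := fun k =>
    dirEig (k+1) ^ (t - 2*s) * (dirEig (k+1) ^ s * dirCoeffOne (k+1)) ^ 2
  have hodd (k : ℕ) : f (2 * k + 1) = 0 := by
    have : dirCoeffOne (2 * k + 1 + 1) = 0 :=
      dirCoeffOne_of_even (by lia) (by simp [parity_simps])
    simp [f, this]
  have heven (k : ℕ) : f (2 * k) = 4 * π ^ (2*t - 2) * (2*(k:ℝ)+1) ^ (2*t - 2) := by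
    simpa [f] using dirEig_rpow_mul_sq_of_odd (odd_two_mul_add_one k) t s
  have heq : ∑' k, ENNReal.ofReal (f k) =
      ∑' k : ℕ, ENNReal.ofReal (4 * π ^ (2*t - 2) * (2*(k:ℝ)+1) ^ (2*t - 2)) := by
    rw [← tsum_even_add_odd ENNReal.summable ENNReal.summable]
    simp [hodd, heven]
  have hnot : ¬ Summable (fun k : ℕ => 4 * π ^ (2*t - 2) * (2*(k:ℝ)+1) ^ (2*t - 2)) := by
    rw [summable_mul_left_iff (by positivity)]
    exact not_summable_odd_rpow (by linarith)
  have htop : ∑' k, ENNReal.ofReal (f k) = ∞ :=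
    heq.trans (tsum_ofReal_eq_top_of_not_summable (fun k => by positivity) hnot)
  refine ⟨heq, htop, fun h => hnot ?_⟩
  exact (h.comp_injective (mul_right_injective₀ two_ne_zero)).congr heven
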